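/- Let M, N, K be positive integers with K ≥ 2 and N ≥ (K+1)M−1, and let r_1,…,r_K be reals with 0 ≤ r_i ≤ M for each i. Then the supremum over tuples (D_1,…,D_K) of reals with 0 ≤ D_i ≤ M for each i and D_1+⋯+D_K ≤ min(N,KM), of the minimum over nonempty subsets A ⊆ {1,…,K} of d^{D_A}_{|A|M,N}(R_A) (where D_A = Σ_{a∈A} D_a and R_A = Σ_{a∈A} r_a), equals d^{FC}_{M,N}(max(r_1,…,r_K)). -/

import Mathlib

/-- The index `l` of the interval of average dimensions per channel use `D`
to which `D` belongs: the smallest `l` with `D ≤ (MN − l(l+1))/(N+M−1−2l)`. -/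
noncomputable def lIdx (M N : ℕ) (D : ℝ) : ℕ :=
  sInf {l : ℕ |
    D ≤ ((M : ℝ) * (N : ℝ) - (l : ℝ) * ((l : ℝ) + 1)) /
        ((N : ℝ) + (M : ℝ) - 1 - 2 * (l : ℝ))}

/-- The upper bound `d^{D}_{M,N}(r)` on the DMT of infinite constellations with
`D` average dimensions per channel use, in a point-to-point channel with `M`
transmit and `N` receive antennas.  It vanishes for `r ≥ D` or `D = 0`, and for
`0 ≤ r < D` it is the straight line `((M−l)(N−l)/(D−l))·(D−r)` where `l = lIdx M N D`
is determined by the interval of `D`. -/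
noncomputable def dIC (M N : ℕ) (D r : ℝ) : ℝ :=
  if D ≤ 0 ∨ D ≤ r then 0
  else
    (((M : ℝ) - (lIdx M N D : ℝ)) * ((N : ℝ) - (lIdx M N D : ℝ)) /
        (D - (lIdx M N D : ℝ))) * (D - r)

/-- The optimal point-to-point DMT `d^{FC}_{M,N}(r)` of finite constellations:
the piecewise linear function through the points `(l, (M−l)(N−l))`. -/
noncomputable def dFC (M N : ℕ) (r : ℝ) : ℝ :=
  ((M : ℝ) - (⌊r⌋ : ℝ)) * ((N : ℝ) - (⌊r⌋ : ℝ))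
    + (r - (⌊r⌋ : ℝ)) *
      (((M : ℝ) - (⌊r⌋ : ℝ) - 1) * ((N : ℝ) - (⌊r⌋ : ℝ) - 1)
        - ((M : ℝ) - (⌊r⌋ : ℝ)) * ((N : ℝ) - (⌊r⌋ : ℝ)))

/-- The optimal symmetric multiple-access DMT `d^{FC}_{K,M,N}(r)` of finite
constellations: it equals `d^{FC}_{M,N}(r)` for `r ≤ min(N/(K+1), M)` and
`d^{FC}_{KM,N}(K·r)` afterwards. -/
noncomputable def dFCmac (K M N : ℕ) (r : ℝ) : ℝ :=
  if r ≤ min ((N : ℝ) / ((K : ℝ) + 1)) (M : ℝ) then dFC M N r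
  else dFC (K * M) N ((K : ℝ) * r)

lemma lIdx_spec (m n : ℕ) (hmn : m ≤ n) (D : ℝ) (hD : 0 < D) (hDm : D ≤ m) :
    lIdx m n D + 1 ≤ m ∧ (lIdx m n D : ℝ) < D ∧
    (D - lIdx m n D) * ((n : ℝ) + m - 1 - 2 * lIdx m n D)
      ≤ ((m : ℝ) - lIdx m n D) * ((n : ℝ) - lIdx m n D) ∧
    (1 ≤ lIdx m n D → ((m : ℝ) - lIdx m n D) * ((n : ℝ) - lIdx m n D)
      ≤ (D - lIdx m n D) * ((n : ℝ) + m + 1 - 2 * lIdx m n D)) := by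
  have hm : 1 ≤ m := by
    rcases Nat.eq_zero_or_pos m with h | h
    · subst h; norm_num at hDm; linarith
    · exact h
  have hmnR : (m : ℝ) ≤ n := by exact_mod_cast hmn
  have hmem : (m - 1) ∈ {l : ℕ | D ≤ ((m : ℝ) * (n : ℝ) - (l : ℝ) * ((l : ℝ) + 1)) /
        ((n : ℝ) + (m : ℝ) - 1 - 2 * (l : ℝ))} := by
    simp only [Set.mem_setOf_eq]
    push_cast [hm]
    rw [le_div_iff₀ (by linarith)]
    nlinarith
  have hle : lIdx m n D ≤ m - 1 := Nat.sInf_le hmem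
  have hin := Nat.sInf_mem ⟨_, hmem⟩
  change lIdx m n D ∈ _ at hin
  have hnot : ∀ i, i < lIdx m n D → ¬ (D ≤ ((m : ℝ) * (n : ℝ) - (i : ℝ) * ((i : ℝ) + 1)) /
        ((n : ℝ) + (m : ℝ) - 1 - 2 * (i : ℝ))) := fun i hi => Nat.notMem_of_lt_sInf hi
  generalize lIdx m n D = j at *
  have hj : j + 1 ≤ m := by omega
  have hjR : (j : ℝ) + 1 ≤ m := by exact_mod_cast hj
  simp only [Set.mem_setOf_eq] at hin
  rw [le_div_iff₀ (by linarith)] at hin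
  have h4 : 1 ≤ j → ((m : ℝ) - j) * ((n : ℝ) - j) < (D - j) * ((n : ℝ) + m + 1 - 2 * j) := by
    intro h1
    have := hnot (j - 1) (by omega)
    push_cast [h1] at this
    rw [not_le, div_lt_iff₀ (by linarith)] at this
    nlinarith
  refine ⟨hj, ?_, by nlinarith, fun h => (h4 h).le⟩
  rcases Nat.eq_zero_or_pos j with h | h
  · subst h; simpa using hD
  · have h5 := h4 h
    have h6 : 0 < ((m : ℝ) - j) * ((n : ℝ) - j) := mul_pos (by linarith) (by linarith)
    have h7 : 0 < D - j := by
      by_contra hc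
      have := mul_nonneg (by linarith : 0 ≤ -(D - j)) (by linarith : 0 ≤ (n : ℝ) + m + 1 - 2 * j)
      linarith
    linarith

lemma dFC_rep (M N : ℕ) (hM : 0 < M) (r : ℝ) (h0 : 0 ≤ r) (h1 : r ≤ M) :
    ∃ l : ℕ, l + 1 ≤ M ∧ (l : ℝ) ≤ r ∧ r ≤ l + 1 ∧
      dFC M N r = ((M : ℝ) - l) * ((N : ℝ) - l) - (r - l) * ((N : ℝ) + M - 1 - 2 * l) := by
  rcases eq_or_lt_of_le h1 with h | h
  · refine ⟨M - 1, by omega, ?_, ?_, ?_⟩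
    · push_cast [hM]; linarith
    · push_cast [hM]; linarith
    · subst h
      have : (1 : ℕ) ≤ M := hM
      unfold dFC
      push_cast [this]
      simp
      ring
  · refine ⟨⌊r⌋₊, ?_, Nat.floor_le h0, (Nat.lt_floor_add_one r).le, ?_⟩
    · exact (Nat.floor_lt h0).2 h
    · unfold dFC
      rw [← natCast_floor_eq_intCast_floor h0]
      ring

lemma dFC_support (M N : ℕ) (hM : 0 < M) (r s : ℝ) (j : ℕ) (h0 : 0 ≤ r) (h1 : r ≤ M)
    (hs : (N : ℝ) + M - 1 - 2 * j ≤ s) (hs' : 1 ≤ j → s ≤ (N : ℝ) + M + 1 - 2 * j) :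
    ((M : ℝ) - j) * ((N : ℝ) - j) - (r - j) * s ≤ dFC M N r := by
  obtain ⟨f, hf, hfr, hrf, he⟩ := dFC_rep M N hM r h0 h1
  rw [he]
  rcases le_or_gt j f with h | h
  · obtain ⟨p, rfl⟩ := Nat.exists_eq_add_of_le h
    have hp : (0 : ℝ) ≤ (p : ℝ) * p - p := by
      rcases Nat.eq_zero_or_pos p with h | h
      · simp [h]
      · have : (1 : ℝ) ≤ p := by exact_mod_cast h
        nlinarith
    push_cast at *
    have a1 := mul_le_mul_of_nonneg_left hs (by linarith [Nat.cast_nonneg (α := ℝ) p] : 0 ≤ r - j)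
    have a2 := mul_nonneg (by linarith : 0 ≤ r - (j + p)) (Nat.cast_nonneg (α := ℝ) p)
    nlinarith
  · obtain ⟨p, rfl⟩ := Nat.exists_eq_add_of_lt h
    have hs2 := hs' (by omega)
    have hp : (0 : ℝ) ≤ (p : ℝ) * p - p := by
      rcases Nat.eq_zero_or_pos p with h | h
      · simp [h]
      · have : (1 : ℝ) ≤ p := by exact_mod_cast h
        nlinarith
    have hp0 := Nat.cast_nonneg (α := ℝ) p
    push_cast at *
    have a1 := mul_le_mul_of_nonneg_left hs2 (by linarith : 0 ≤ (f + p + 1) - r)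
    have a2 := mul_nonneg (by linarith : 0 ≤ f + 1 - r) hp0
    nlinarith

lemma dFC_nonneg (M N : ℕ) (hM : 0 < M) (hMN : M ≤ N) (r : ℝ) (h0 : 0 ≤ r) (h1 : r ≤ M) :
    0 ≤ dFC M N r := by
  obtain ⟨l, hl, hlr, hrl, he⟩ := dFC_rep M N hM r h0 h1
  rw [he]
  have hl' : (l : ℝ) + 1 ≤ M := by exact_mod_cast hl
  have hMN' : (M : ℝ) ≤ N := by exact_mod_cast hMN
  have a1 := mul_nonneg (by linarith : 0 ≤ l + 1 - r)
    (mul_nonneg (by linarith : 0 ≤ (M : ℝ) - l) (by linarith : 0 ≤ (N : ℝ) - l))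
  have a2 := mul_nonneg (by linarith : 0 ≤ r - l)
    (mul_nonneg (by linarith : 0 ≤ (M : ℝ) - l - 1) (by linarith : 0 ≤ (N : ℝ) - l - 1))
  nlinarith

lemma dIC_le_dFC (M N : ℕ) (hM : 0 < M) (hMN : M ≤ N) (D r : ℝ) (hD : D ≤ M)
    (h0 : 0 ≤ r) (h1 : r ≤ M) : dIC M N D r ≤ dFC M N r := by
  unfold dIC
  split_ifs with h
  · exact dFC_nonneg M N hM hMN r h0 h1
  · push Not at h
    obtain ⟨b1, b2, b3, b4⟩ := lIdx_spec M N hMN D h.1 hD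
    generalize lIdx M N D = j at *
    have hpos : 0 < D - j := by linarith
    have := dFC_support M N hM r (((M : ℝ) - j) * ((N : ℝ) - j) / (D - j)) j h0 h1
      (by rw [le_div_iff₀ hpos]; linarith)
      (fun hj => by rw [div_le_iff₀ hpos]; linarith [b4 hj])
    refine le_trans (le_of_eq ?_) this
    field_simp
    ring

/-- The key integer inequality. -/
lemma key_int (k a q : ℤ) (hk : 1 ≤ k) (ha : 1 ≤ a) (hq : 1 ≤ q) :
    0 ≤ k * (q * q - q + a * a - a) - 2 * (a - 1) * q := by
  have hb : 0 ≤ q * q - q + a * a - a := by nlinarith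
  rcases eq_or_lt_of_le hk with h | h
  · subst h
    rcases le_or_gt a q with h | h
    · nlinarith [mul_nonneg (sub_nonneg.2 h) (sub_nonneg.2 h)]
    · nlinarith [mul_nonneg (by linarith : 0 ≤ a - q) (by linarith : 0 ≤ a - q - 1)]
  · have : 2 * (q * q - q + a * a - a) ≤ k * (q * q - q + a * a - a) :=
      mul_le_mul_of_nonneg_right (by linarith) hb
    rcases eq_or_lt_of_le ha with h | h
    · subst h; nlinarith
    · nlinarith [sq_nonneg (2 * q - a), mul_nonneg (by linarith : 0 ≤ a) (by linarith : 0 ≤ a - 2)]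

lemma key_real (k M N l j : ℕ) (hk : 1 ≤ k) (hl : l + 1 ≤ M) (hj : j + 1 ≤ k * M)
    (hN : (k + 1) * M ≤ N + 1) :
    ((N : ℝ) + M - 1 - 2 * l) * (k * l - j)
      ≤ k * (((k : ℝ) * M - j) * ((N : ℝ) - j) - ((M : ℝ) - l) * ((N : ℝ) - l)) := by
  have h1 := key_int k ((M : ℤ) - l) ((k : ℤ) * M - j) (by exact_mod_cast hk)
    (by have : (l : ℤ) + 1 ≤ M := by exact_mod_cast hl
        linarith)
    (by have : (j : ℤ) + 1 ≤ k * M := by exact_mod_cast hj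
        linarith)
  have h2 : (0 : ℝ) ≤ k * (((k : ℝ) * M - j) * (k * M - j) - (k * M - j) +
      (M - l) * (M - l) - (M - l)) - 2 * (M - l - 1) * (k * M - j) := by exact_mod_cast h1
  have hk' : (1 : ℝ) ≤ k := by exact_mod_cast hk
  have hj' : (j : ℝ) + 1 ≤ k * M := by exact_mod_cast hj
  have hl' : (l : ℝ) + 1 ≤ M := by exact_mod_cast hl
  have hN' : ((k : ℝ) + 1) * M ≤ N + 1 := by exact_mod_cast hN
  have h3 := mul_nonneg (mul_nonneg (by linarith : (0 : ℝ) ≤ k - 1) (by linarith : 0 ≤ (k : ℝ) * M - j))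
    (by linarith : 0 ≤ (N : ℝ) + 1 - (k + 1) * M)
  linarith

lemma lower (k M N l : ℕ) (hk : 1 ≤ k) (hl : l + 1 ≤ M) (hN : (k + 1) * M ≤ N + 1)
    (D ρ R : ℝ) (hD : (D - l) * ((N : ℝ) + M - 1 - 2 * l) = ((M : ℝ) - l) * ((N : ℝ) - l))
    (hDM : D ≤ M) (hR : R ≤ k * ρ) :
    ((M : ℝ) - l) * ((N : ℝ) - l) - (ρ - l) * ((N : ℝ) + M - 1 - 2 * l)
      ≤ dIC (k * M) N (k * D) R := by
  have hk' : (1 : ℝ) ≤ k := by exact_mod_cast hk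
  have hl' : (l : ℝ) + 1 ≤ M := by exact_mod_cast hl
  have hN' : ((k : ℝ) + 1) * M ≤ N + 1 := by exact_mod_cast hN
  have hl0 := Nat.cast_nonneg (α := ℝ) l
  have hMN' : (M : ℝ) ≤ N := by nlinarith
  have hs : 0 < (N : ℝ) + M - 1 - 2 * l := by nlinarith
  have hkMN : k * M ≤ N := by nlinarith
  have hkMN' : (k : ℝ) * M ≤ N := by exact_mod_cast hkMN
  have hDl : 0 < D - l := by
    have : 0 < ((M : ℝ) - l) * ((N : ℝ) - l) := mul_pos (by linarith) (by linarith)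
    rw [← hD] at this
    exact (pos_iff_pos_of_mul_pos this).2 hs
  have hlhs : ((M : ℝ) - l) * ((N : ℝ) - l) - (ρ - l) * ((N : ℝ) + M - 1 - 2 * l)
      = ((N : ℝ) + M - 1 - 2 * l) * (D - ρ) := by rw [← hD]; ring
  rw [hlhs]
  have hkD : 0 < (k : ℝ) * D := mul_pos (by linarith) (by linarith)
  unfold dIC
  split_ifs with h
  · have h' : (k : ℝ) * D ≤ k * ρ := (h.resolve_left (by linarith)).trans hR
    have : D ≤ ρ := le_of_mul_le_mul_left h' (by linarith)
    exact mul_nonpos_of_nonneg_of_nonpos hs.le (by linarith)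
  · push Not at h
    obtain ⟨b1, b2, -, -⟩ := lIdx_spec (k * M) N hkMN (k * D) hkD
      (by push_cast; exact mul_le_mul_of_nonneg_left hDM (by linarith))
    generalize lIdx (k * M) N (k * D) = j at *
    have hkey := key_real k M N l j hk hl b1 hN
    have hj : (j : ℝ) + 1 ≤ k * M := by exact_mod_cast b1
    have hpos : 0 < (k : ℝ) * D - j := by linarith
    push_cast
    have hS0 : 0 ≤ ((k : ℝ) * M - j) * (N - j) / (k * D - j) :=
      div_nonneg (mul_nonneg (by linarith) (by linarith)) hpos.le
    have hS : (N : ℝ) + M - 1 - 2 * l ≤ k * (((k : ℝ) * M - j) * (N - j) / (k * D - j)) := by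
      rw [← mul_div_assoc, le_div_iff₀ hpos]
      linear_combination hkey + (k : ℝ) * hD
    generalize ((k : ℝ) * M - j) * (N - j) / (k * D - j) = S at *
    rcases le_or_gt D ρ with hc | hc
    · exact (mul_nonpos_of_nonneg_of_nonpos hs.le (by linarith)).trans
        (mul_nonneg hS0 (by linarith))
    · calc _ ≤ k * S * (D - ρ) := mul_le_mul_of_nonneg_right hS (by linarith)
        _ = S * (k * D - k * ρ) := by ring
        _ ≤ _ := mul_le_mul_of_nonneg_left (by linarith) hS0

theorem stmt13 (M N K : ℕ) (hM : 0 < M) (hN : 0 < N) (hK : 2 ≤ K)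
    (hNK : (K + 1) * M - 1 ≤ N)
    (r : Fin K → ℝ) (hr : ∀ i, 0 ≤ r i ∧ r i ≤ (M : ℝ)) :
    sSup {x : ℝ | ∃ D : Fin K → ℝ,
        (∀ i, 0 ≤ D i ∧ D i ≤ (M : ℝ)) ∧
        (∑ i, D i) ≤ min (N : ℝ) ((K : ℝ) * (M : ℝ)) ∧
        x = sInf {y : ℝ | ∃ A : Finset (Fin K), A.Nonempty ∧
              y = dIC (A.card * M) N (∑ a ∈ A, D a) (∑ a ∈ A, r a)}}
      = dFC M N (Finset.univ.sup' ⟨⟨0, by omega⟩, Finset.mem_univ _⟩ r) := by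
  have hMN : M ≤ N := by
    have : 3 * M ≤ (K + 1) * M := Nat.mul_le_mul_right _ (by omega)
    omega
  have hKN : K * M ≤ N := by
    have : (K + 1) * M = K * M + M := by ring
    omega
  have hKN' : (K : ℝ) * M ≤ N := by exact_mod_cast hKN
  obtain ⟨i₀, -, hi₀⟩ := Finset.exists_mem_eq_sup' (s := Finset.univ)
    ⟨⟨0, by omega⟩, Finset.mem_univ _⟩ r
  have hle : ∀ i, r i ≤ r i₀ := fun i => by
    rw [← hi₀]; exact Finset.le_sup' r (Finset.mem_univ i)
  rw [hi₀]
  have hbdd : ∀ D : Fin K → ℝ, BddBelow {y : ℝ | ∃ A : Finset (Fin K), A.Nonempty ∧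
              y = dIC (A.card * M) N (∑ a ∈ A, D a) (∑ a ∈ A, r a)} := fun D => by
    refine ((Set.finite_range (fun A : Finset (Fin K) =>
      dIC (A.card * M) N (∑ a ∈ A, D a) (∑ a ∈ A, r a))).subset ?_).bddBelow
    rintro y ⟨A, -, rfl⟩
    exact ⟨A, rfl⟩
  have hub : ∀ D : Fin K → ℝ, (∀ i, 0 ≤ D i ∧ D i ≤ (M : ℝ)) →
      sInf {y : ℝ | ∃ A : Finset (Fin K), A.Nonempty ∧
              y = dIC (A.card * M) N (∑ a ∈ A, D a) (∑ a ∈ A, r a)} ≤ dFC M N (r i₀) := by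
    intro D hD
    refine (csInf_le (hbdd D) ⟨{i₀}, Finset.singleton_nonempty _, rfl⟩).trans ?_
    simp only [Finset.card_singleton, Finset.sum_singleton, one_mul]
    exact dIC_le_dFC M N hM hMN _ _ (hD i₀).2 (hr i₀).1 (hr i₀).2
  apply IsGreatest.csSup_eq
  refine ⟨?_, ?_⟩
  · obtain ⟨l, hl, -, -, he⟩ := dFC_rep M N hM (r i₀) (hr i₀).1 (hr i₀).2
    have hl' : (l : ℝ) + 1 ≤ M := by exact_mod_cast hl
    have hMN' : (M : ℝ) ≤ N := by exact_mod_cast hMN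
    have hs : 0 < (N : ℝ) + M - 1 - 2 * l := by linarith
    obtain ⟨D, hDdef⟩ : ∃ D : ℝ,
      D = l + ((M : ℝ) - l) * ((N : ℝ) - l) / ((N : ℝ) + M - 1 - 2 * l) := ⟨_, rfl⟩
    have hDeq : (D - l) * ((N : ℝ) + M - 1 - 2 * l) = ((M : ℝ) - l) * ((N : ℝ) - l) := by
      rw [hDdef, add_sub_cancel_left, div_mul_cancel₀ _ hs.ne']
    have hD0 : 0 ≤ D := by
      rw [hDdef]
      exact add_nonneg (Nat.cast_nonneg _)
        (div_nonneg (mul_nonneg (by linarith) (by linarith)) hs.le)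
    have hDM : D ≤ M := by
      have : ((M : ℝ) - l) * ((N : ℝ) - l) / ((N : ℝ) + M - 1 - 2 * l) ≤ M - l := by
        rw [div_le_iff₀ hs]
        exact mul_le_mul_of_nonneg_left (by linarith) (by linarith)
      linarith
    refine ⟨fun _ => D, fun _ => ⟨hD0, hDM⟩, ?_, ?_⟩
    · rw [min_eq_right hKN']
      simp only [Finset.sum_const, Finset.card_univ, Fintype.card_fin, nsmul_eq_mul]
      exact mul_le_mul_of_nonneg_left hDM (Nat.cast_nonneg _)
    · refine le_antisymm ?_ (hub _ fun _ => ⟨hD0, hDM⟩)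
      refine le_csInf ⟨_, {i₀}, Finset.singleton_nonempty _, rfl⟩ ?_
      rintro y ⟨A, hA, rfl⟩
      rw [he]
      simp only [Finset.sum_const, nsmul_eq_mul]
      have hcard : A.card ≤ K := by simpa using Finset.card_le_univ A
      refine lower A.card M N l hA.card_pos hl ?_ D (r i₀) _ hDeq hDM ?_
      · have : (A.card + 1) * M ≤ (K + 1) * M := Nat.mul_le_mul_right _ (by omega)
        omega
      · have := Finset.sum_le_card_nsmul A r (r i₀) (fun i _ => hle i)
        simpa using this
  · rintro x ⟨D, hD, -, rfl⟩
    exact hub D hD
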